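/- arXiv:0804.3657 — 3 statements merged into one kernel-verified Lean document; each statement's English description precedes it below -/
import Mathlib

section
/- Let A be an element of the special unitary group SU(3, ℂ). If the trace of A is a real number (i.e., conj(tr A) = tr A), then 1 is an eigenvalue of A, i.e., det(A − I) = 0. (Indeed the characteristic polynomial X³ − aX² + aX − 1 factors as (X − 1)(X² + (1 − a)X + 1).) -/
open Matrix

theorem det_sub_one_fin_three {R : Type*} [CommRing R] (A : Matrix (Fin 3) (Fin 3) R) :
    (A - 1).det = A.det - A.adjugate.trace + A.trace - 1 := by
  simp [det_fin_three, adjugate_fin_three, trace_fin_three, one_apply]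
  ring

theorem adjugate_eq_conjTranspose_of_det_eq_one {n R : Type*} [Fintype n] [DecidableEq n]
    [CommRing R] [StarRing R] {A : Matrix n n R} (hA : Aᴴ * A = 1) (hdet : A.det = 1) :
    A.adjugate = Aᴴ := by
  calc A.adjugate = Aᴴ * A * A.adjugate := by rw [hA, one_mul]
    _ = Aᴴ := by rw [mul_assoc, mul_adjugate, hdet, one_smul, mul_one]

/-- If `A ∈ SU(3, ℂ)` has real trace (i.e. `conj (tr A) = tr A`), then `1` is an
eigenvalue of `A`, i.e. `det (A − I) = 0`. -/
theorem one_is_eigenvalue_of_real_trace (A : Matrix (Fin 3) (Fin 3) ℂ)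
    (hA : Aᴴ * A = 1) (hdet : A.det = 1)
    (htr : starRingEnd ℂ A.trace = A.trace) :
    (A - 1).det = 0 := by
  rw [starRingEnd_apply] at htr
  rw [det_sub_one_fin_three, adjugate_eq_conjTranspose_of_det_eq_one hA hdet,
    trace_conjTranspose, htr, hdet]
  ring
end

section
/- Let A ∈ SU(3, ℂ) and suppose there exists B ∈ SU(3, ℂ) such that A·B = B·Ā, where Ā denotes the matrix obtained from A by applying complex conjugation to every entry. Then 1 is an eigenvalue of A, i.e., det(A − I) = 0. -/
open Matrix

/-- For an isometry `A` of determinant one in odd dimension, `det (Aᴴ - 1) = -det (A - 1)`. -/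
theorem det_conjTranspose_sub_one_eq_neg {n R : Type*} [Fintype n] [DecidableEq n]
    [CommRing R] [StarRing R] (hn : Odd (Fintype.card n)) {A : Matrix n n R}
    (hA : Aᴴ * A = 1) (hdet : A.det = 1) : (Aᴴ - 1).det = -(A - 1).det := by
  have h : Aᴴ - 1 = Aᴴ * -(A - 1) := by rw [neg_sub, mul_sub, mul_one, hA]
  rw [h, det_mul, det_conjTranspose, hdet, star_one, one_mul, det_neg, hn.neg_one_pow,
    neg_one_mul]

/-- If `A ∈ SU(3, ℂ)` and there is `B ∈ SU(3, ℂ)` with `A·B = B·Ā` (where `Ā` is the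
entrywise complex conjugate of `A`), then `1` is an eigenvalue of `A`. -/
theorem one_is_eigenvalue_of_conj_intertwiner (A B : Matrix (Fin 3) (Fin 3) ℂ)
    (hA : Aᴴ * A = 1) (hAdet : A.det = 1)
    (hB : Bᴴ * B = 1) (hBdet : B.det = 1)
    (hAB : A * B = B * A.map (starRingEnd ℂ)) :
    (A - 1).det = 0 := by
  have hconj : (A - 1).det = (Aᴴ - 1).det := by
    have h : (A - 1) * B = B * (A.map (starRingEnd ℂ) - 1) := by
      rw [sub_mul, mul_sub, hAB, one_mul, mul_one]
    have hdet := congrArg det h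
    rw [det_mul, det_mul, hBdet, mul_one, one_mul] at hdet
    rw [hdet, ← det_transpose, transpose_sub, transpose_one]
    rfl
  rw [det_conjTranspose_sub_one_eq_neg (by decide) hA hAdet] at hconj
  exact self_eq_neg.mp hconj
end

section
/- For every A ∈ SU(3, ℂ), the centralizer of A in SU(3, ℂ) is conjugate within SU(3, ℂ) to exactly one of the following three subgroups: (i) the subgroup T of all diagonal matrices in SU(3, ℂ); (ii) the subgroup {blockDiag((det S)⁻¹, S) | S ∈ U(2, ℂ)}; (iii) the whole group SU(3, ℂ). That is, there exists g ∈ SU(3, ℂ) with g·Z(A)·g⁻¹ equal to one of these three subgroups, and no two of the three subgroups are conjugate to each other in SU(3, ℂ). -/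
open Matrix

/-- The special unitary group `SU(3, ℂ)` as a set of matrices. -/
def SU3 : Set (Matrix (Fin 3) (Fin 3) ℂ) :=
  {g | gᴴ * g = 1 ∧ g.det = 1}

/-- The centralizer of `A` in `SU(3, ℂ)`. -/
def centralizerSU3 (A : Matrix (Fin 3) (Fin 3) ℂ) : Set (Matrix (Fin 3) (Fin 3) ℂ) :=
  {g | g ∈ SU3 ∧ g * A = A * g}

/-- Conjugation of a set of matrices by `g`. -/
noncomputable def conjSet (g : Matrix (Fin 3) (Fin 3) ℂ)
    (S : Set (Matrix (Fin 3) (Fin 3) ℂ)) : Set (Matrix (Fin 3) (Fin 3) ℂ) :=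
  (fun x => g * x * g⁻¹) '' S

/-- The subgroup of all diagonal matrices in `SU(3, ℂ)` (a maximal torus). -/
def torusSU3 : Set (Matrix (Fin 3) (Fin 3) ℂ) :=
  {g | g ∈ SU3 ∧ ∃ l : Fin 3 → ℂ, g = Matrix.diagonal l}

/-- `blockDiagMat S` is the 3×3 matrix with `(1,1)`-entry `(det S)⁻¹`, lower-right
2×2 block `S`, and zeros elsewhere. -/
noncomputable def blockDiagMat (S : Matrix (Fin 2) (Fin 2) ℂ) :
    Matrix (Fin 3) (Fin 3) ℂ :=
  !![(S.det)⁻¹, 0, 0; 0, S 0 0, S 0 1; 0, S 1 0, S 1 1]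

/-- The image of `U(2, ℂ)` in `SU(3, ℂ)` under `S ↦ blockDiag((det S)⁻¹, S)`. -/
def imageU2 : Set (Matrix (Fin 3) (Fin 3) ℂ) :=
  {g | ∃ S : Matrix (Fin 2) (Fin 2) ℂ, Sᴴ * S = 1 ∧ g = blockDiagMat S}

/-- A complex unitary matrix is unitarily diagonalizable: the inverse Cayley transform reduces
this to the spectral theorem for Hermitian matrices. -/
theorem Matrix.exists_unitary_conj_eq_diagonal {n : Type*} [Fintype n] [DecidableEq n]
    {A : Matrix n n ℂ} (hA : Aᴴ * A = 1) :
    ∃ (U : Matrix n n ℂ) (d : n → ℂ), Uᴴ * U = 1 ∧ Uᴴ * A * U = diagonal d := by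
  obtain ⟨ζ, hζ, hζA⟩ : ∃ ζ : ℂ, star ζ * ζ = 1 ∧ A.charpoly.eval ζ ≠ 0 := by
    have hinf : (Metric.sphere (0 : ℂ) 1).Infinite := by
      refine (isPreconnected_sphere (by simp) 0 1).infinite_of_nontrivial
        ⟨1, by simp, -1, by simp, ?_⟩
      norm_num
    obtain ⟨ζ, hζ, hζA⟩ := hinf.exists_notMem_finset A.charpoly.roots.toFinset
    refine ⟨ζ, ?_, fun h => hζA ?_⟩
    · have : ‖ζ‖ = 1 := by simpa using hζ
      simpa [this] using Complex.conj_mul' ζ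
    · simpa [A.charpoly_monic.ne_zero] using h
  set Z : Matrix n n ℂ := Matrix.scalar n ζ with hZ
  have hZZ : Zᴴ * Z = 1 := by
    rw [hZ, scalar_apply, diagonal_conjTranspose, diagonal_mul_diagonal, ← diagonal_one]
    exact congrArg _ (funext fun _ => hζ)
  have hdet : IsUnit (Z - A).det := by
    rw [isUnit_iff_ne_zero, hZ, ← Matrix.eval_charpoly]
    exact hζA
  obtain ⟨K, hKM⟩ : ∃ K : Matrix n n ℂ, K * (Z - A) = Complex.I • (Z + A) :=
    ⟨Complex.I • ((Z + A) * (Z - A)⁻¹), by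
      rw [smul_mul_assoc, nonsing_inv_mul_cancel_right _ _ hdet]⟩
  have hKH : K.IsHermitian := by
    have hu : IsUnit (Z - A) := (isUnit_iff_isUnit_det _).2 hdet
    have hu' : IsUnit (Z - A)ᴴ := hu.star
    have hKM' : (Z - A)ᴴ * Kᴴ = -Complex.I • (Z + A)ᴴ := by
      rw [← conjTranspose_mul, hKM, conjTranspose_smul]
      simp
    apply hu.mul_right_cancel
    apply hu'.mul_left_cancel
    rw [← mul_assoc, hKM', hKM, conjTranspose_sub, conjTranspose_add]
    simp only [smul_mul_assoc, mul_smul_comm, add_mul, mul_add, sub_mul, mul_sub, hA, hZZ, neg_smul,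
      neg_mul, smul_add, smul_sub]
    abel
  have hcayley : (K + Complex.I • 1) * A = ζ • (K - Complex.I • 1) := by
    have h1 : K * Z = ζ • K := by simp [hZ, ← Matrix.smul_eq_mul_diagonal]
    have h2 : Z = ζ • 1 := by rw [hZ, scalar_apply, smul_one_eq_diagonal]
    rw [mul_sub, h1, h2] at hKM
    rw [add_mul, smul_mul_assoc, one_mul, smul_sub, sub_eq_iff_eq_add.1 hKM, smul_add,
      smul_comm ζ]
    abel
  set U : Matrix n n ℂ := (hKH.eigenvectorUnitary : Matrix n n ℂ) with hU
  have hUU : Uᴴ * U = 1 := mem_unitaryGroup_iff'.1 hKH.eigenvectorUnitary.2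
  have hUU' : U * Uᴴ = 1 := mem_unitaryGroup_iff.1 hKH.eigenvectorUnitary.2
  set D : Matrix n n ℂ := diagonal (fun i => (hKH.eigenvalues i : ℂ)) with hD
  have hKU : Uᴴ * K * U = D := by
    have := hKH.conjStarAlgAut_star_eigenvectorUnitary
    rw [Unitary.conjStarAlgAut_star_apply] at this
    exact this
  have hB : (D + Complex.I • 1) * (Uᴴ * A * U) = ζ • (D - Complex.I • 1) := by
    have h1 : (D + Complex.I • 1) * (Uᴴ * A * U) = Uᴴ * ((K + Complex.I • 1) * A) * U := by
      have : D + Complex.I • 1 = Uᴴ * (K + Complex.I • 1) * U := by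
        rw [mul_add, add_mul, hKU, mul_smul_comm, smul_mul_assoc, mul_one, hUU]
      rw [this]
      calc _ = Uᴴ * (K + Complex.I • 1) * (U * Uᴴ) * A * U := by simp only [mul_assoc]
        _ = _ := by rw [hUU', mul_one]; simp only [mul_assoc]
    rw [h1, hcayley, mul_smul_comm, smul_mul_assoc, mul_sub, sub_mul, hKU, mul_smul_comm,
      smul_mul_assoc, mul_one, hUU]
  refine ⟨U, fun i => (Uᴴ * A * U) i i, hUU, ?_⟩
  ext i j
  by_cases hij : i = j
  · simp [hij]
  · have h := congrFun (congrFun hB i) j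
    have hDI : D + Complex.I • 1 = diagonal (fun i => (hKH.eigenvalues i : ℂ) + Complex.I) := by
      rw [hD, smul_one_eq_diagonal, diagonal_add]
    rw [hDI, diagonal_mul] at h
    have hne : (hKH.eigenvalues i : ℂ) + Complex.I ≠ 0 := fun h0 => by
      simpa using congrArg Complex.im h0
    rw [diagonal_apply_ne _ hij]
    refine (mul_eq_zero.1 (h.trans ?_)).resolve_left hne
    simp [hD, hij]

theorem SU3.mul_conjTranspose {g : Matrix (Fin 3) (Fin 3) ℂ} (hg : g ∈ SU3) : g * gᴴ = 1 :=
  mul_eq_one_comm.1 hg.1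

theorem SU3.inv_eq {g : Matrix (Fin 3) (Fin 3) ℂ} (hg : g ∈ SU3) : g⁻¹ = gᴴ :=
  inv_eq_left_inv hg.1

theorem SU3.mul_mem {g h : Matrix (Fin 3) (Fin 3) ℂ} (hg : g ∈ SU3) (hh : h ∈ SU3) :
    g * h ∈ SU3 := by
  refine ⟨?_, by rw [det_mul, hg.2, hh.2, one_mul]⟩
  calc (g * h)ᴴ * (g * h) = hᴴ * (gᴴ * g) * h := by simp only [conjTranspose_mul, mul_assoc]
    _ = 1 := by rw [hg.1, mul_one, hh.1]

theorem SU3.conjTranspose_mem {g : Matrix (Fin 3) (Fin 3) ℂ} (hg : g ∈ SU3) : gᴴ ∈ SU3 :=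
  ⟨by rw [conjTranspose_conjTranspose, SU3.mul_conjTranspose hg],
    by rw [det_conjTranspose, hg.2, star_one]⟩

/-- A unitary matrix can be rescaled by a unit complex number to land in `SU(3, ℂ)`. -/
theorem exists_smul_mem_SU3 {V : Matrix (Fin 3) (Fin 3) ℂ} (hV : Vᴴ * V = 1) :
    ∃ c : ℂ, star c * c = 1 ∧ c • V ∈ SU3 := by
  have hdet : star V.det * V.det = 1 := by
    rw [← det_conjTranspose, ← det_mul, hV, det_one]
  obtain ⟨c, hc⟩ := IsAlgClosed.exists_pow_nat_eq (star V.det) (n := 3) (by norm_num)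
  have hnV : ‖V.det‖ = 1 := by
    have h := congrArg norm hdet
    rw [norm_mul, norm_star, norm_one] at h
    nlinarith [norm_nonneg V.det]
  have hn : ‖c‖ = 1 := by
    have h := congrArg norm hc
    rw [norm_pow, norm_star, hnV] at h
    exact (pow_eq_one_iff_of_nonneg (norm_nonneg c) (by norm_num)).1 h
  have hcc : star c * c = 1 := by simpa [hn] using Complex.conj_mul' c
  refine ⟨c, hcc, ?_, ?_⟩
  · rw [conjTranspose_smul, smul_mul_smul_comm, hV, hcc, one_smul]
  · rw [det_smul, Fintype.card_fin, hc, hdet]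

theorem exists_mem_SU3_conj_eq_diagonal {A : Matrix (Fin 3) (Fin 3) ℂ} (hA : A ∈ SU3) :
    ∃ d : Fin 3 → ℂ, ∀ σ : Equiv.Perm (Fin 3), ∃ g ∈ SU3, g * A * gᴴ = diagonal (d ∘ σ) := by
  obtain ⟨U, d, hU, hd⟩ := Matrix.exists_unitary_conj_eq_diagonal hA.1
  have hU' : U * Uᴴ = 1 := mul_eq_one_comm.1 hU
  refine ⟨d, fun σ => ?_⟩
  set V : Matrix (Fin 3) (Fin 3) ℂ := Uᴴ.submatrix σ id with hVdef
  have hVH : Vᴴ = U.submatrix id σ := by simp [hVdef, conjTranspose_submatrix]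
  have hV : Vᴴ * V = 1 := by
    rw [hVH, hVdef, submatrix_mul_equiv, hU', submatrix_id_id]
  have hVA : V * A * Vᴴ = diagonal (d ∘ σ) := by
    have hAsub : A = A.submatrix id id := rfl
    rw [hVH, hVdef]
    conv_lhs => rw [hAsub]
    rw [← submatrix_mul _ _ _ _ _ Function.bijective_id,
      ← submatrix_mul _ _ _ _ _ Function.bijective_id, hd, submatrix_diagonal_equiv]
  obtain ⟨c, hc, hcV⟩ := exists_smul_mem_SU3 hV
  refine ⟨c • V, hcV, ?_⟩
  rw [conjTranspose_smul, smul_mul_assoc, smul_mul_smul_comm, hVA, mul_comm, hc, one_smul]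

theorem conjSet_centralizerSU3 {g : Matrix (Fin 3) (Fin 3) ℂ} (hg : g ∈ SU3)
    (A : Matrix (Fin 3) (Fin 3) ℂ) :
    conjSet g (centralizerSU3 A) = centralizerSU3 (g * A * gᴴ) := by
  have h1 := hg.1
  have h2 := SU3.mul_conjTranspose hg
  have key : ∀ X Y : Matrix (Fin 3) (Fin 3) ℂ, (g * X * gᴴ) * (g * Y * gᴴ) = g * (X * Y) * gᴴ := by
    intro X Y
    calc _ = g * X * (gᴴ * g) * Y * gᴴ := by simp only [mul_assoc]
      _ = _ := by rw [h1, mul_one]; simp only [mul_assoc]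
  ext y
  rw [conjSet, SU3.inv_eq hg]
  constructor
  · rintro ⟨x, ⟨hx, hxA⟩, rfl⟩
    exact ⟨SU3.mul_mem (SU3.mul_mem hg hx) (SU3.conjTranspose_mem hg),
      by simp only [key, hxA]⟩
  · rintro ⟨hy, hyA⟩
    have hyx : g * (gᴴ * y * g) * gᴴ = y := by
      calc _ = (g * gᴴ) * y * (g * gᴴ) := by simp only [mul_assoc]
        _ = y := by rw [h2, one_mul, mul_one]
    refine ⟨gᴴ * y * g, ⟨SU3.mul_mem (SU3.mul_mem (SU3.conjTranspose_mem hg) hy) hg, ?_⟩, hyx⟩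
    rw [← hyx, key, key] at hyA
    have h := congrArg (fun X => gᴴ * X * g) hyA
    have cancel : ∀ X : Matrix (Fin 3) (Fin 3) ℂ, gᴴ * (g * X * gᴴ) * g = X := by
      intro X
      calc _ = (gᴴ * g) * X * (gᴴ * g) := by simp only [mul_assoc]
        _ = X := by rw [h1, one_mul, mul_one]
    simpa only [cancel] using h

theorem mem_centralizerSU3_diagonal {d : Fin 3 → ℂ} {g : Matrix (Fin 3) (Fin 3) ℂ} :
    g ∈ centralizerSU3 (diagonal d) ↔ g ∈ SU3 ∧ ∀ i j, d i ≠ d j → g i j = 0 := by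
  refine and_congr_right fun _ => ?_
  rw [← Matrix.ext_iff]
  refine forall₂_congr fun i j => ?_
  rw [mul_diagonal, diagonal_mul, mul_comm, ← sub_eq_zero, ← sub_mul, mul_eq_zero, sub_eq_zero,
    or_iff_not_imp_left, eq_comm]

theorem centralizerSU3_diagonal_of_injective {d : Fin 3 → ℂ} (hd : Function.Injective d) :
    centralizerSU3 (diagonal d) = torusSU3 := by
  ext g
  rw [mem_centralizerSU3_diagonal]
  refine and_congr_right fun _ => ⟨fun h => ⟨fun i => g i i, ?_⟩, ?_⟩
  · ext i j
    by_cases hij : i = j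
    · simp [hij]
    · rw [diagonal_apply_ne _ hij, h i j (hd.ne hij)]
  · rintro ⟨l, rfl⟩ i j hij
    exact diagonal_apply_ne _ fun h => hij (h ▸ rfl)

theorem blockDiagMat_mem_SU3 {S : Matrix (Fin 2) (Fin 2) ℂ} (hS : Sᴴ * S = 1) :
    blockDiagMat S ∈ SU3 := by
  have hdet : star S.det * S.det = 1 := by
    rw [← det_conjTranspose, ← det_mul, hS, det_one]
  have hne : S.det ≠ 0 := right_ne_zero_of_mul_eq_one hdet
  have hinv : star (S.det)⁻¹ * (S.det)⁻¹ = 1 := by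
    rw [star_inv₀, ← mul_inv, hdet, inv_one]
  refine ⟨?_, ?_⟩
  · rw [← Matrix.ext_iff] at hS ⊢
    have h00 := hS 0 0
    have h01 := hS 0 1
    have h10 := hS 1 0
    have h11 := hS 1 1
    simp only [mul_apply, conjTranspose_apply, Fin.sum_univ_two] at h00 h01 h10 h11
    rw [blockDiagMat]
    generalize (S.det)⁻¹ = t at hinv ⊢
    intro i j
    fin_cases i <;> fin_cases j <;>
      simp_all [mul_apply, Fin.sum_univ_three]
  · rw [blockDiagMat, det_fin_three]
    have h2 := det_fin_two S
    simp
    rw [mul_assoc, mul_assoc, ← mul_sub, ← h2, inv_mul_cancel₀ hne]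

theorem centralizerSU3_diagonal_of_eq {d : Fin 3 → ℂ} (h01 : d 0 ≠ d 1) (h12 : d 1 = d 2) :
    centralizerSU3 (diagonal d) = imageU2 := by
  ext g
  rw [mem_centralizerSU3_diagonal]
  constructor
  · rintro ⟨hg, h⟩
    have g01 := h 0 1 h01
    have g02 := h 0 2 (h12 ▸ h01)
    have g10 := h 1 0 h01.symm
    have g20 := h 2 0 (h12 ▸ h01.symm)
    have hdet := hg.2
    rw [det_fin_three, g01, g02, g10, g20] at hdet
    have hS : g 0 0 * (!![g 1 1, g 1 2; g 2 1, g 2 2] : Matrix (Fin 2) (Fin 2) ℂ).det = 1 := by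
      rw [det_fin_two_of]
      linear_combination hdet
    refine ⟨!![g 1 1, g 1 2; g 2 1, g 2 2], ?_, ?_⟩
    · have hu := Matrix.ext_iff.2 hg.1
      have u11 := hu 1 1
      have u12 := hu 1 2
      have u21 := hu 2 1
      have u22 := hu 2 2
      simp [mul_apply, Fin.sum_univ_three, g01, g02] at u11 u12 u21 u22
      ext i j
      fin_cases i <;> fin_cases j <;> simpa [mul_apply, Fin.sum_univ_two]
    · rw [blockDiagMat, ← eq_inv_of_mul_eq_one_left hS]
      ext i j
      fin_cases i <;> fin_cases j <;> simp [g01, g02, g10, g20]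
  · rintro ⟨S, hS, rfl⟩
    refine ⟨blockDiagMat_mem_SU3 hS, fun i j hij => ?_⟩
    fin_cases i <;> fin_cases j <;> simp_all [blockDiagMat]

theorem centralizerSU3_diagonal_of_const {d : Fin 3 → ℂ} (h : ∀ i j, d i = d j) :
    centralizerSU3 (diagonal d) = SU3 := by
  ext g
  rw [mem_centralizerSU3_diagonal]
  exact and_iff_left fun i j hij => absurd (h i j) hij

/-- A family indexed by `Fin 3` is, up to a permutation of the indices, injective, constant, or
such that its last two values agree and differ from the first. -/
theorem exists_perm_fin_three_pattern {α : Type*} (d : Fin 3 → α) :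
    ∃ σ : Equiv.Perm (Fin 3), Function.Injective (d ∘ σ) ∨
      ((d ∘ σ) 0 ≠ (d ∘ σ) 1 ∧ (d ∘ σ) 1 = (d ∘ σ) 2) ∨ ∀ i j, (d ∘ σ) i = (d ∘ σ) j := by
  by_cases h01 : d 0 = d 1
  · by_cases h12 : d 1 = d 2
    · refine ⟨1, .inr <| .inr fun i j => ?_⟩
      fin_cases i <;> fin_cases j <;> simp [h01, h12]
    · refine ⟨Equiv.swap 0 2, .inr <| .inl ?_⟩
      have : Equiv.swap (0 : Fin 3) 2 1 = 1 := by decide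
      simp [this, h01, Ne.symm h12]
  · by_cases h12 : d 1 = d 2
    · exact ⟨1, .inr <| .inl ⟨h01, h12⟩⟩
    · by_cases h02 : d 0 = d 2
      · refine ⟨Equiv.swap 0 1, .inr <| .inl ?_⟩
        have : Equiv.swap (0 : Fin 3) 1 2 = 2 := by decide
        simp [this, h02, h12]
      · refine ⟨1, .inl fun i j hij => ?_⟩
        fin_cases i <;> fin_cases j <;> simp_all [eq_comm]

theorem conj_injective_of_mem_SU3 {g : Matrix (Fin 3) (Fin 3) ℂ} (hg : g ∈ SU3) :
    Function.Injective fun x => g * x * g⁻¹ := by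
  have hu : IsUnit g := .of_mul_eq_one _ (SU3.mul_conjTranspose hg)
  have hu' : IsUnit g⁻¹ := by rwa [isUnit_nonsing_inv_iff]
  exact fun x y h => hu.mul_left_cancel (hu'.mul_right_cancel h)

theorem mem_of_conjSet_eq_SU3 {g x : Matrix (Fin 3) (Fin 3) ℂ}
    {S : Set (Matrix (Fin 3) (Fin 3) ℂ)} (hg : g ∈ SU3) (h : conjSet g S = SU3) (hx : x ∈ SU3) :
    x ∈ S := by
  have hgx : g * x * g⁻¹ ∈ conjSet g S := by
    rw [h, SU3.inv_eq hg]
    exact SU3.mul_mem (SU3.mul_mem hg hx) (SU3.conjTranspose_mem hg)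
  obtain ⟨y, hy, hyx⟩ := hgx
  exact conj_injective_of_mem_SU3 hg hyx ▸ hy

theorem cyclicMatrix_mem_SU3 :
    (!![0, 1, 0; 0, 0, 1; 1, 0, 0] : Matrix (Fin 3) (Fin 3) ℂ) ∈ SU3 := by
  refine ⟨?_, by simp [det_fin_three]⟩
  ext i j
  fin_cases i <;> fin_cases j <;> simp [mul_apply, Fin.sum_univ_three]

theorem conjSet_torusSU3_ne_SU3 {g : Matrix (Fin 3) (Fin 3) ℂ} (hg : g ∈ SU3) :
    conjSet g torusSU3 ≠ SU3 := fun h => by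
  obtain ⟨-, l, hl⟩ := mem_of_conjSet_eq_SU3 hg h cyclicMatrix_mem_SU3
  simpa using congrFun (congrFun hl 0) 1

theorem conjSet_imageU2_ne_SU3 {g : Matrix (Fin 3) (Fin 3) ℂ} (hg : g ∈ SU3) :
    conjSet g imageU2 ≠ SU3 := fun h => by
  obtain ⟨S, -, hS⟩ := mem_of_conjSet_eq_SU3 hg h cyclicMatrix_mem_SU3
  simpa [blockDiagMat] using congrFun (congrFun hS 0) 1

theorem commute_of_mem_conjSet_torusSU3 {g x y : Matrix (Fin 3) (Fin 3) ℂ} (hg : g ∈ SU3)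
    (hx : x ∈ conjSet g torusSU3) (hy : y ∈ conjSet g torusSU3) : x * y = y * x := by
  obtain ⟨_, ⟨-, a, rfl⟩, rfl⟩ := hx
  obtain ⟨_, ⟨-, b, rfl⟩, rfl⟩ := hy
  have hinv : g⁻¹ * g = 1 := by rw [SU3.inv_eq hg, hg.1]
  have key : ∀ X Y : Matrix (Fin 3) (Fin 3) ℂ,
      (g * X * g⁻¹) * (g * Y * g⁻¹) = g * (X * Y) * g⁻¹ := by
    intro X Y
    calc _ = g * X * (g⁻¹ * g) * Y * g⁻¹ := by simp only [mul_assoc]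
      _ = _ := by rw [hinv, mul_one]; simp only [mul_assoc]
  simp only [key, diagonal_mul_diagonal, mul_comm]

theorem conjSet_torusSU3_ne_imageU2 {g : Matrix (Fin 3) (Fin 3) ℂ} (hg : g ∈ SU3) :
    conjSet g torusSU3 ≠ imageU2 := fun h => by
  have hx : blockDiagMat !![0, 1; 1, 0] ∈ imageU2 := by
    refine ⟨_, ?_, rfl⟩
    ext i j
    fin_cases i <;> fin_cases j <;> simp [mul_apply, Fin.sum_univ_two]
  have hy : blockDiagMat !![1, 0; 0, -1] ∈ imageU2 := by
    refine ⟨_, ?_, rfl⟩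
    ext i j
    fin_cases i <;> fin_cases j <;> simp [mul_apply, Fin.sum_univ_two]
  rw [← h] at hx hy
  have hcomm := congrFun (congrFun (commute_of_mem_conjSet_torusSU3 hg hx hy) 1) 2
  simp [blockDiagMat, mul_apply, Fin.sum_univ_three] at hcomm
  norm_num [neg_eq_iff_add_eq_zero] at hcomm

/-- For every `A ∈ SU(3, ℂ)`, the centralizer of `A` in `SU(3, ℂ)` is conjugate within
`SU(3, ℂ)` to exactly one of: the diagonal torus, the embedded `U(2, ℂ)`, or the whole
group `SU(3, ℂ)`; moreover no two of these three subgroups are conjugate in `SU(3, ℂ)`. -/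
theorem centralizer_SU3_classification :
    (∀ A ∈ SU3, ∃ g ∈ SU3,
      conjSet g (centralizerSU3 A) = torusSU3 ∨
      conjSet g (centralizerSU3 A) = imageU2 ∨
      conjSet g (centralizerSU3 A) = SU3) ∧
    (∀ g ∈ SU3, conjSet g torusSU3 ≠ imageU2 ∧
      conjSet g torusSU3 ≠ SU3 ∧ conjSet g imageU2 ≠ SU3) := by
  refine ⟨fun A hA => ?_, fun g hg => ⟨conjSet_torusSU3_ne_imageU2 hg,
    conjSet_torusSU3_ne_SU3 hg, conjSet_imageU2_ne_SU3 hg⟩⟩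
  obtain ⟨d, hd⟩ := exists_mem_SU3_conj_eq_diagonal hA
  obtain ⟨σ, hσ⟩ := exists_perm_fin_three_pattern d
  obtain ⟨g, hg, hgA⟩ := hd σ
  refine ⟨g, hg, ?_⟩
  rw [conjSet_centralizerSU3 hg, hgA]
  rcases hσ with h | ⟨h01, h12⟩ | h
  · exact .inl (centralizerSU3_diagonal_of_injective h)
  · exact .inr (.inl (centralizerSU3_diagonal_of_eq h01 h12))
  · exact .inr (.inr (centralizerSU3_diagonal_of_const h))
end
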